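/- arXiv:0908.1981 — 3 statements merged into one kernel-verified Lean document; each statement's English description precedes it below -/
import Mathlib

section
/- Let N ≥ 1, let σ : Fin N → Fin N be the cyclic permutation x ↦ x+1 (mod N), and let τ be an involution of Fin N whose support has exactly 2k elements, such that the k chords {a, τ(a)} (for a in the support of τ) are pairwise non-interleaving. Then the permutation σ ∘ τ has exactly k+1 orbits on Fin N, where fixed points count as singleton orbits. (This is the combinatorial content of the key step in the paper's genus bound: smoothing a knot shadow with c crossings along a set of pairwise parallel chords of its chord diagram produces one more component than the number of chords smoothed, so that smoothing at c − tr(D) pairwise parallel chords yields a (c − tr(D) + 1)-component link.) -/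
/-- The chords `{a,b}` and `{c,d}` on the marked points `0, …, N-1` interleave
(cross inside the circle): writing each chord with its endpoints in increasing
order as `{a', b'}` (`a' < b'`) and `{c', d'}` (`c' < d'`), this means
`a' < c' < b' < d'` or `c' < a' < d' < b'`. -/
def InterleavePts {N : ℕ} (a b c d : Fin N) : Prop :=
  (min a b < min c d ∧ min c d < max a b ∧ max a b < max c d) ∨
  (min c d < min a b ∧ min a b < max c d ∧ max c d < max a b)

namespace Equiv.Perm

/-- A function invariant under a permutation is constant on its cycles. -/
theorem SameCycle.eq_of_invariant {α β : Type*} {f : Perm α} {g : α → β}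
    (hg : ∀ x, g (f x) = g x) {x y : α} (h : SameCycle f x y) : g x = g y := by
  obtain ⟨i, rfl⟩ := h
  induction i using Int.induction_on with
  | zero => simp
  | succ i ih => rw [add_comm, zpow_add, zpow_one, mul_apply, hg, ih]
  | pred i ih =>
    have h := hg ((f ^ (-(i : ℤ) - 1)) x)
    rwa [← mul_apply, ← zpow_one_add, add_sub_cancel, ← ih] at h

/-- The orbits of the group generated by a permutation are the classes of `SameCycle`. -/
theorem orbitRel_zpowers_iff_sameCycle {α : Type*} (f : Perm α) (x y : α) :
    MulAction.orbitRel (Subgroup.zpowers f) α x y ↔ SameCycle f x y := by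
  rw [sameCycle_comm, MulAction.orbitRel_apply, MulAction.mem_orbit_iff]
  simp [SameCycle, Subgroup.smul_def, Subgroup.exists_zpowers]

theorem card_orbits_eq_card_sameCycle {α : Type*} (f : Perm α) :
    Nat.card (MulAction.orbitRel.Quotient (Subgroup.zpowers f) α) =
      Nat.card (Quotient (SameCycle.setoid f)) :=
  Nat.card_congr (Quotient.congrRight (orbitRel_zpowers_iff_sameCycle f))

/-- Multiplying by a transposition that cuts a cycle in two creates exactly one new cycle. -/
theorem card_sameCycle_mul_swap {α : Type*} [Finite α] [DecidableEq α] (f : Perm α) {a b : α}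
    (h : SameCycle f a b) (h' : ¬ SameCycle (f * swap a b) a b) :
    Nat.card (Quotient (SameCycle.setoid (f * swap a b))) =
      Nat.card (Quotient (SameCycle.setoid f)) + 1 := by
  classical
  set f' := f * swap a b with hf'
  let Q := Quotient (SameCycle.setoid f')
  let p : α → Q := Quotient.mk _
  have p_eq {x y : α} : p x = p y ↔ SameCycle f' x y := Quotient.eq
  have hab : p a ≠ p b := fun e => h' (p_eq.1 e)
  have p_apply (x : α) : p (f' x) = p x := p_eq.2 (sameCycle_apply_left.2 (SameCycle.refl _ _))
  have f_apply (x : α) : f x = f' (swap a b x) := by simp [hf']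
  let g : α → {q : Q // q ≠ p b} := fun x =>
    if hx : p x = p b then ⟨p a, hab⟩ else ⟨p x, hx⟩
  have g_apply (x : α) : g (f x) = g x := by
    have : p (f x) = p (swap a b x) := by rw [f_apply, p_apply]
    by_cases ha : x = a
    · subst ha
      simp [g, this, hab]
    by_cases hb : x = b
    · subst hb
      simp [g, this, hab]
    · simp [g, this, swap_apply_of_ne_of_ne ha hb]
  have swap_rel (x : α) : SameCycle f (swap a b x) x := by
    by_cases ha : x = a
    · subst ha
      simpa using h.symm
    by_cases hb : x = b
    · subst hb
      simpa using h
    · rw [swap_apply_of_ne_of_ne ha hb]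
  let r : α → Quotient (SameCycle.setoid f) := Quotient.mk _
  have r_eq {x y : α} : r x = r y ↔ SameCycle f x y := Quotient.eq
  have r_apply (x : α) : r (f' x) = r x :=
    r_eq.2 (sameCycle_apply_left.2 (swap_rel x))
  let e : Quotient (SameCycle.setoid f) ≃ {q : Q // q ≠ p b} :=
    { toFun := Quotient.lift g fun _ _ hxy => SameCycle.eq_of_invariant g_apply hxy
      invFun := fun q => Quotient.lift r (fun _ _ hxy => SameCycle.eq_of_invariant r_apply hxy) q.1
      left_inv := by
        rintro ⟨x⟩
        change Quotient.lift r _ (g x).1 = r x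
        by_cases hx : p x = p b
        · simp only [g, hx, dite_true]
          exact (r_eq.2 h).trans (SameCycle.eq_of_invariant r_apply (p_eq.1 hx)).symm
        · simp only [g, hx, dite_false]
          rfl
      right_inv := by
        rintro ⟨⟨x⟩, hx⟩
        change g x = ⟨p x, hx⟩
        exact dif_neg hx }
  rw [Nat.card_congr e, ← Finite.card_option]
  exact (Nat.card_congr (optionSubtypeNe (p b))).symm

end Equiv.Perm

theorem Fin.val_add_one_of_val_lt {N : ℕ} [NeZero N] {x : Fin N} (h : (x : ℕ) + 1 < N) :
    ((x + 1 : Fin N) : ℕ) = x + 1 := by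
  rw [Fin.val_add, Fin.val_one', Nat.add_mod_mod, Nat.mod_eq_of_lt h]

/-- If `f` acts as the successor on `[a, b)`, then `a` and `b` lie on the same cycle. -/
theorem sameCycle_of_apply_eq_add_one {N : ℕ} [NeZero N] {f : Equiv.Perm (Fin N)} {a b : Fin N}
    (hab : a ≤ b) (hf : ∀ x, a ≤ x → x < b → f x = x + 1) : f.SameCycle a b := by
  suffices H : ∀ d : ℕ, ∀ x : Fin N, x ≤ b → (x : ℕ) = a + d → f.SameCycle a x from
    H (b - a) b le_rfl (by have : (a : ℕ) ≤ b := hab; omega)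
  intro d
  induction d with
  | zero =>
    intro x _ hx
    obtain rfl : x = a := Fin.ext (by simpa using hx)
    exact Equiv.Perm.SameCycle.refl _ _
  | succ d ih =>
    intro x hxb hx
    have hb : (x : ℕ) ≤ b := hxb
    let y : Fin N := ⟨a + d, by omega⟩
    have hy : f y = x := by
      rw [hf y (Fin.le_def.2 (by simp [y])) (Fin.lt_def.2 (by simp only [y]; omega))]
      apply Fin.ext
      rw [Fin.val_add_one_of_val_lt] <;> simp only [y] <;> omega
    rw [← hy]
    exact Equiv.Perm.sameCycle_apply_right.2 (ih y (Fin.le_def.2 (by simp only [y]; omega)) rfl)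

/-- A nontrivial non-crossing involution has a chord with no other chord endpoint below it. -/
theorem exists_innermost_chord {N : ℕ} {τ : Equiv.Perm (Fin N)} (hτ : ∀ x, τ (τ x) = x)
    (hne : τ.support.Nonempty)
    (hpar : ∀ a ∈ τ.support, ∀ b ∈ τ.support,
      ({a, τ a} : Finset (Fin N)) ≠ {b, τ b} → ¬ InterleavePts a (τ a) b (τ b)) :
    ∃ a, a < τ a ∧ ∀ x, a < x → x < τ a → τ x = x := by
  have hS : (Finset.univ.filter fun a => a < τ a).Nonempty := by
    obtain ⟨c, hc⟩ := hne
    rw [Equiv.Perm.mem_support] at hc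
    rcases lt_or_gt_of_ne hc with h | h
    · exact ⟨τ c, by simpa [hτ] using h⟩
    · exact ⟨c, by simpa using h⟩
  obtain ⟨a, ha, hmin⟩ := Finset.exists_min_image _ (fun a => (τ a : ℕ) - a) hS
  have haτ : a < τ a := by simpa using ha
  refine ⟨a, haτ, fun x hax hxb => ?_⟩
  by_contra hx
  have hxa : τ x ≠ a := fun e => hxb.ne (by rw [← e, hτ])
  have hxτ : τ x ≠ τ a := fun e => hax.ne' (τ.injective e)
  have hcross := hpar a (by simpa using haτ.ne') x (by simpa using hx) (by
    intro e
    have : a ∈ ({x, τ x} : Finset (Fin N)) := e ▸ Finset.mem_insert_self _ _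
    simp only [Finset.mem_insert, Finset.mem_singleton] at this
    exact this.elim hax.ne hxa.symm)
  have hmin' (y : Fin N) (hy : y < τ y) : (τ a : ℕ) - a ≤ τ y - y := hmin y (by simpa using hy)
  have h₁ := hmin' x
  have h₂ := hmin' (τ x)
  rw [hτ] at h₂
  simp only [InterleavePts, Fin.lt_def, Fin.ext_iff, Fin.coe_min, Fin.coe_max, ne_eq] at *
  omega

/-- Let `N ≥ 1`, let `σ : Fin N → Fin N` be the cyclic permutation `x ↦ x + 1 (mod N)`,
and let `τ` be an involution of `Fin N` whose support has exactly `2k` elements, such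
that the `k` chords `{a, τ a}` (for `a` in the support of `τ`) are pairwise
non-interleaving.  Then the permutation `σ ∘ τ` has exactly `k + 1` orbits on `Fin N`
(fixed points counting as singleton orbits). -/
theorem orbits_of_smoothing_parallel_chords (N : ℕ) [NeZero N]
    (σ τ : Equiv.Perm (Fin N))
    (hσ : ∀ x : Fin N, σ x = x + 1)
    (hτ : ∀ x : Fin N, τ (τ x) = x)
    (k : ℕ) (hsupp : τ.support.card = 2 * k)
    (hpar : ∀ a ∈ τ.support, ∀ b ∈ τ.support,
      ({a, τ a} : Finset (Fin N)) ≠ {b, τ b} → ¬ InterleavePts a (τ a) b (τ b)) :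
    Nat.card (MulAction.orbitRel.Quotient (Subgroup.zpowers (σ * τ)) (Fin N)) = k + 1 := by
  rw [Equiv.Perm.card_orbits_eq_card_sameCycle]
  induction k generalizing τ with
  | zero =>
    obtain rfl : τ = 1 := by simpa using hsupp
    rw [mul_one, zero_add, Nat.card_eq_one_iff_exists]
    refine ⟨Quotient.mk _ 0, ?_⟩
    rintro ⟨x⟩
    exact Quotient.sound
      (sameCycle_of_apply_eq_add_one (Fin.zero_le x) fun y _ _ => hσ y).symm
  | succ k ih =>
    obtain ⟨a, hab, hin⟩ := exists_innermost_chord hτ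
      (Finset.card_pos.1 (by omega)) hpar
    set b := τ a with hb
    have hba : τ b = a := hτ a
    set τ' := τ * Equiv.swap a b with hτ'
    have ha' : τ' a = a := by simp [hτ', hba]
    have hb' : τ' b = b := by simp [hτ', hb]
    have hx' {x : Fin N} (hxa : x ≠ a) (hxb : x ≠ b) : τ' x = τ x := by
      simp [hτ', Equiv.swap_apply_of_ne_of_ne hxa hxb]
    have hmem {x : Fin N} : x ∈ τ'.support ↔ x ∈ τ.support ∧ x ≠ a ∧ x ≠ b := by
      by_cases hxa : x = a
      · simp [hxa, ha']
      by_cases hxb : x = b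
      · simp [hxb, hb']
      · simp [hxa, hxb, hx' hxa hxb]
    have hsupp' : τ'.support = τ.support \ {a, b} := by
      ext x
      simp only [hmem, Finset.mem_sdiff, Finset.mem_insert, Finset.mem_singleton, not_or]
    have hcard : τ'.support.card = 2 * k := by
      have hsub : ({a, b} : Finset (Fin N)) ⊆ τ.support := by
        intro x hx
        simp only [Finset.mem_insert, Finset.mem_singleton] at hx
        rcases hx with rfl | rfl
        · simpa using hab.ne'
        · simpa [hba] using hab.ne
      rw [hsupp', Finset.card_sdiff_of_subset hsub, Finset.card_pair hab.ne, hsupp]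
      omega
    have hfix {x : Fin N} (hxa : a ≤ x) (hxb : x < b) : τ' x = x := by
      rcases hxa.eq_or_lt with rfl | h
      · exact ha'
      · rw [hx' h.ne' hxb.ne, hin x h hxb]
    have key := ih τ' (fun x => by
        by_cases hxa : x = a
        · rw [hxa, ha', ha']
        by_cases hxb : x = b
        · rw [hxb, hb', hb']
        · rw [hx' hxa hxb, hx' _ _, hτ]
          · exact fun e => hxb (by rw [hb, ← e, hτ])
          · exact fun e => hxa (τ.injective e)) hcard
      (fun x hx y hy => by
        obtain ⟨hx, hxa, hxb⟩ := hmem.1 hx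
        obtain ⟨hy, hya, hyb⟩ := hmem.1 hy
        rw [hx' hxa hxb, hx' hya hyb]
        exact hpar x hx y hy)
    have hmul : σ * τ = σ * τ' * Equiv.swap a b := by
      simp [hτ', mul_assoc]
    have hsame : (σ * τ').SameCycle a b :=
      sameCycle_of_apply_eq_add_one hab.le fun x hxa hxb => by
        rw [Equiv.Perm.mul_apply, hfix hxa hxb, hσ]
    have hstep (x : Fin N) (hxa : a < x) (hxb : x ≤ b) :
        a < (σ * τ) x ∧ (σ * τ) x ≤ b := by
      have hN := b.isLt
      rw [Equiv.Perm.mul_apply, hσ]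
      rcases hxb.eq_or_lt with rfl | h
      · rw [hba]
        rw [Fin.lt_def] at hab
        rw [Fin.lt_def, Fin.le_def, Fin.val_add_one_of_val_lt] <;> omega
      · rw [hin x hxa h]
        rw [Fin.lt_def] at hxa h
        rw [Fin.lt_def, Fin.le_def, Fin.val_add_one_of_val_lt] <;> omega
    have hnot : ¬ (σ * τ' * Equiv.swap a b).SameCycle a b := by
      rw [← hmul]
      intro h
      obtain ⟨i, -, hi⟩ := h.symm.exists_pow_eq'
      have hpow (n : ℕ) : a < ((σ * τ) ^ n) b ∧ ((σ * τ) ^ n) b ≤ b := by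
        induction n with
        | zero => simpa using hab
        | succ n ihn =>
          rw [pow_succ', Equiv.Perm.mul_apply]
          exact hstep _ ihn.1 ihn.2
      exact absurd hi (hpow i).1.ne'
    rw [hmul, Equiv.Perm.card_sameCycle_mul_swap _ hsame hnot, key]
end

section
/- Let A₀ be a finite set of arrows on Fin N whose endpoints are pairwise distinct, and let p₁ < q₁ < p₂ < q₂ be four further points of Fin N, distinct from all endpoints of arrows of A₀, with q₂ strictly larger than every endpoint of every arrow of A₀ (so that the base point 0 directly follows the endpoint q₂ of the chord b = {q₁,q₂}, which interleaves the chord a = {p₁,p₂}). For the four ways of orienting a and b, set a₊ = (p₁,p₂), a₋ = (p₂,p₁), b₊ = (q₁,q₂), b₋ = (q₂,q₁), and for ε,δ ∈ {+,−} let A_{εδ} = A₀ ∪ {a_ε, b_δ}. Then |C(A₊₊)| + |C(A₊₋)| + |C(A₋₊)| + |C(A₋₋)| is an odd integer. (This is the combinatorial core of the paper's Lemma that a classical pseudodiagram with exactly two precrossings whose chords intersect can be resolved nontrivially: it shows that the mod-2 sum of the Polyak–Viro counts for the second Vassiliev invariant ν₂ over the four resolutions of the two precrossings is 1, hence some resolution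 has ν₂ ≠ 0.) -/
/-- An arrow on `Fin N` is an ordered pair `(h, t)` of distinct points, thought of
as a chord oriented from its head `h` to its tail `t`.  A finite set of arrows has
pairwise distinct endpoints if each arrow has distinct head and tail, and distinct
arrows share no endpoints. -/
def ArrowEndpointsDistinct {N : ℕ} (A : Finset (Fin N × Fin N)) : Prop :=
  (∀ x ∈ A, x.1 ≠ x.2) ∧
  ∀ x ∈ A, ∀ y ∈ A, x ≠ y →
    x.1 ≠ y.1 ∧ x.1 ≠ y.2 ∧ x.2 ≠ y.1 ∧ x.2 ≠ y.2

/-- The Polyak–Viro count for the second Vassiliev invariant `ν₂`: the set of ordered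
pairs `(x, y)` of distinct arrows of `A` whose endpoints occur in the order
`x_H, y_T, x_T, y_H` when traversing the circle from the base point `0`, i.e. with
`x.head < y.tail < x.tail < y.head` in the natural order on `Fin N`.
(An arrow is the ordered pair (head, tail).) -/
def PVCount {N : ℕ} (A : Finset (Fin N × Fin N)) :
    Finset ((Fin N × Fin N) × (Fin N × Fin N)) :=
  (A ×ˢ A).filter (fun p =>
    p.1 ≠ p.2 ∧ p.1.1 < p.2.2 ∧ p.2.2 < p.1.2 ∧ p.1.2 < p.2.1)

/-- The indicator of the Polyak–Viro configuration on a pair of arrows. -/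
def pvIndicator {N : ℕ} (x y : Fin N × Fin N) : ℕ :=
  if x.1 < y.2 ∧ y.2 < x.2 ∧ x.2 < y.1 then 1 else 0

theorem pvIndicator_self {N : ℕ} (x : Fin N × Fin N) : pvIndicator x x = 0 := by
  simp [pvIndicator]

theorem card_PVCount {N : ℕ} (A : Finset (Fin N × Fin N)) :
    (PVCount A).card = ∑ x ∈ A, ∑ y ∈ A, pvIndicator x y := by
  rw [PVCount, Finset.card_filter, Finset.sum_product]
  refine Finset.sum_congr rfl fun x _ => Finset.sum_congr rfl fun y _ => ?_
  by_cases h : x = y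
  · subst h
    simp [pvIndicator]
  · simp [pvIndicator, h]

theorem card_PVCount_union_pair {N : ℕ} (A : Finset (Fin N × Fin N))
    {a b : Fin N × Fin N} (ha : a ∉ A) (hb : b ∉ A) (hab : a ≠ b) :
    (PVCount (A ∪ {a, b})).card = (PVCount A).card
      + (∑ x ∈ A, pvIndicator x a + ∑ x ∈ A, pvIndicator a x)
      + (∑ x ∈ A, pvIndicator x b + ∑ x ∈ A, pvIndicator b x)
      + (pvIndicator a b + pvIndicator b a) := by
  have hdisj : Disjoint A {a, b} := by
    simp [ha, hb]
  simp only [card_PVCount, Finset.sum_union hdisj, Finset.sum_pair hab,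
    Finset.sum_add_distrib, pvIndicator_self]
  ring

/-- Let `A₀` be a finite set of arrows on `Fin N` with pairwise distinct endpoints, and
let `p₁ < q₁ < p₂ < q₂` be four further points, distinct from all endpoints of arrows of
`A₀`, with `q₂` strictly larger than every endpoint of every arrow of `A₀`.  Form the
four arrow sets `A_{εδ} = A₀ ∪ {a_ε, b_δ}` where `a₊ = (p₁,p₂)`, `a₋ = (p₂,p₁)`,
`b₊ = (q₁,q₂)`, `b₋ = (q₂,q₁)`.  Then the total Polyak–Viro count
`|C(A₊₊)| + |C(A₊₋)| + |C(A₋₊)| + |C(A₋₋)|` over the four resolutions is odd. -/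
theorem pv_count_sum_odd {N : ℕ} (A₀ : Finset (Fin N × Fin N))
    (hA₀ : ArrowEndpointsDistinct A₀)
    (p₁ q₁ p₂ q₂ : Fin N)
    (h₁ : p₁ < q₁) (h₂ : q₁ < p₂) (h₃ : p₂ < q₂)
    (hdist : ∀ x ∈ A₀, ∀ e ∈ ({p₁, q₁, p₂, q₂} : Finset (Fin N)),
      x.1 ≠ e ∧ x.2 ≠ e)
    (hmax : ∀ x ∈ A₀, x.1 < q₂ ∧ x.2 < q₂) :
    Odd ((PVCount (A₀ ∪ {(p₁, p₂), (q₁, q₂)})).card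
       + (PVCount (A₀ ∪ {(p₁, p₂), (q₂, q₁)})).card
       + (PVCount (A₀ ∪ {(p₂, p₁), (q₁, q₂)})).card
       + (PVCount (A₀ ∪ {(p₂, p₁), (q₂, q₁)})).card) := by
  have hnot : ∀ e ∈ ({p₁, q₁, p₂, q₂} : Finset (Fin N)), ∀ f, (e, f) ∉ A₀ :=
    fun e he f hmem => (hdist _ hmem e he).1 rfl
  have hp₁ := hnot p₁ (by simp)
  have hq₁ := hnot q₁ (by simp)
  have hp₂ := hnot p₂ (by simp)
  have hq₂ := hnot q₂ (by simp)
  have hpq : ∀ {e e' f f' : Fin N}, e ≠ e' → (e, f) ≠ (e', f') :=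
    fun h h' => h (congrArg Prod.fst h')
  rw [card_PVCount_union_pair A₀ (hp₁ _) (hq₁ _) (hpq h₁.ne),
    card_PVCount_union_pair A₀ (hp₁ _) (hq₂ _) (hpq (h₁.trans (h₂.trans h₃)).ne),
    card_PVCount_union_pair A₀ (hp₂ _) (hq₁ _) (hpq h₂.ne'),
    card_PVCount_union_pair A₀ (hp₂ _) (hq₂ _) (hpq h₃.ne)]
  have hcross : pvIndicator (p₁, p₂) (q₂, q₁) = 1 := if_pos ⟨h₁, h₂, h₃⟩
  have hzero : ∀ {x y : Fin N × Fin N},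
      ¬(x.1 < y.2 ∧ y.2 < x.2 ∧ x.2 < y.1) → pvIndicator x y = 0 := fun h => if_neg h
  rw [hcross,
    hzero (x := (p₁, p₂)) (y := (q₁, q₂)) (by grind),
    hzero (x := (q₁, q₂)) (y := (p₁, p₂)) (by grind),
    hzero (x := (q₂, q₁)) (y := (p₁, p₂)) (by grind),
    hzero (x := (p₂, p₁)) (y := (q₁, q₂)) (by grind),
    hzero (x := (q₁, q₂)) (y := (p₂, p₁)) (by grind),
    hzero (x := (p₂, p₁)) (y := (q₂, q₁)) (by grind),
    hzero (x := (q₂, q₁)) (y := (p₂, p₁)) (by grind)]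
  rw [Nat.odd_iff]
  omega
end

section
/- Let M be a partial matching on Fin N and let T ⊆ M be a subset of its chords such that M∖T is nonempty and noncrossing. Then there exists a chord {u,v} ∈ M∖T, written with u<v, such that every endpoint of a chord of M lying strictly between u and v is an endpoint of a chord of T. (This is the existence of an 'exterior chord' — a chord cutting off an arc containing only endpoints of chords in the trivializing set T — which the paper uses in the proofs that the trivializing number of a shadow equals the minimum number of chords whose deletion leaves only parallel chords, and that every basic trivializing set of a shadow has even cardinality.) -/
/-- A chord on the `N` marked points `0, 1, …, N-1`, recorded as an ordered pair
of endpoints `fst < snd`. -/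
structure Chord (N : ℕ) where
  fst : Fin N
  snd : Fin N
  lt : fst < snd

instance {N : ℕ} : DecidableEq (Chord N) := fun c d =>
  decidable_of_iff (c.fst = d.fst ∧ c.snd = d.snd)
    ⟨fun h => by cases c; cases d; simp_all, fun h => by cases h; exact ⟨rfl, rfl⟩⟩

/-- Two chords `{a,b}` (with `a < b`) and `{c,d}` (with `c < d`) interleave
(cross inside the circle) iff `a < c < b < d` or `c < a < d < b`. -/
def Chord.Interleaves {N : ℕ} (c d : Chord N) : Prop :=
  (c.fst < d.fst ∧ d.fst < c.snd ∧ c.snd < d.snd) ∨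
  (d.fst < c.fst ∧ c.fst < d.snd ∧ d.snd < c.snd)

/-- The set of endpoints of a chord. -/
def Chord.endpoints {N : ℕ} (c : Chord N) : Finset (Fin N) := {c.fst, c.snd}

/-- A partial matching on `Fin N`: a finite set of chords whose endpoints are
pairwise distinct. -/
def PartialMatching {N : ℕ} (M : Finset (Chord N)) : Prop :=
  ∀ c ∈ M, ∀ d ∈ M, c ≠ d → Disjoint c.endpoints d.endpoints

/-- A set of chords is noncrossing if no two of its chords interleave. -/
def Noncrossing {N : ℕ} (S : Finset (Chord N)) : Prop :=
  ∀ c ∈ S, ∀ d ∈ S, ¬ c.Interleaves d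

/-- Let `M` be a partial matching on `Fin N` and `T ⊆ M` a subset of its chords such
that `M \ T` is nonempty and noncrossing.  Then there is an "exterior" chord
`{u, v} ∈ M \ T` (with `u < v`): every endpoint of a chord of `M` lying strictly
between `u` and `v` is an endpoint of a chord of `T`. -/
theorem exists_exterior_chord {N : ℕ} (M T : Finset (Chord N))
    (hM : PartialMatching M) (hTM : T ⊆ M)
    (hne : (M \ T).Nonempty) (hnc : Noncrossing (M \ T)) :
    ∃ c ∈ M \ T, ∀ d ∈ M, ∀ e ∈ d.endpoints,
      c.fst < e → e < c.snd → ∃ t ∈ T, e ∈ t.endpoints := by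
  obtain ⟨c, hc, hmin⟩ :=
    Finset.exists_min_image (M \ T) (fun c => c.snd.val - c.fst.val) hne
  refine ⟨c, hc, fun d hd e he hce hec => ?_⟩
  by_cases hdT : d ∈ T
  · exact ⟨d, hdT, he⟩
  exfalso
  have hdS : d ∈ M \ T := Finset.mem_sdiff.mpr ⟨hd, hdT⟩
  have hlen := hmin d hdS
  have hcross := hnc c hc d hdS
  have hcd : c ≠ d := by
    rintro rfl
    simp only [Chord.endpoints, Finset.mem_insert, Finset.mem_singleton] at he
    rcases he with rfl | rfl
    · exact lt_irrefl _ hce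
    · exact lt_irrefl _ hec
  have hdisj := hM c (Finset.mem_sdiff.mp hc).1 d hd hcd
  have hc_lt := c.lt
  have hd_lt := d.lt
  simp only [Chord.endpoints, Finset.disjoint_insert_left, Finset.disjoint_singleton_left,
    Finset.mem_insert, Finset.mem_singleton, not_or] at he hdisj
  simp only [Chord.Interleaves] at hcross
  rcases he with rfl | rfl <;> omega
end
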